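/- Let 0 < Θ < 1 and let v: [0,∞) × S¹ → C be a smooth bounded solution of (∂_s + i ∂_θ + Θ) v = 0 with ∫_0^∞ ∫_{S¹} |∂_s v|² dθ ds < ∞. Then for any T > 0: (i) ∫_T^∞ ∫_{S¹} |v|² ≤ (1/Θ²) ∫_T^∞ ∫_{S¹} |∂_s v|², and (ii) |v(s,θ)| ≤ √(2/Θ) e^{−Θ s} (∫_0^∞∫_{S¹} |∂_s v|²)^{1/2} (1 − e^{−2T})^{−1/2} for all s ≥ T. -/

import Mathlib

open MeasureTheory
open scoped ENNReal

section
open Complex Set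

/-- The Fourier coefficients of a function on `[0, 2π]` as explicit integrals. -/
theorem fourierCoeffOn_two_pi_eq_integral (f : ℝ → ℂ) (m : ℤ) :
    fourierCoeffOn Real.two_pi_pos f m =
      (1 / (2 * Real.pi) : ℝ) • ∫ x in (0 : ℝ)..2 * Real.pi, exp (-(m * I * x)) * f x := by
  rw [fourierCoeffOn_eq_integral, sub_zero]
  congr 1
  refine intervalIntegral.integral_congr fun x _ => ?_
  simp only [fourier_coe_apply, smul_eq_mul]
  congr 2
  have : (Real.pi : ℂ) ≠ 0 := by exact_mod_cast Real.pi_ne_zero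
  push_cast
  field_simp

/-- Parseval's identity on `[0, 2π]`, in extended nonnegative reals. -/
theorem lintegral_sq_eq_tsum_fourierCoeffOn {f : ℝ → ℂ} (hf : Continuous f) :
    ∫⁻ θ in Ioc (0 : ℝ) (2 * Real.pi), (‖f θ‖₊ : ℝ≥0∞) ^ 2 =
      ∑' m : ℤ, ENNReal.ofReal (2 * Real.pi * ‖fourierCoeffOn Real.two_pi_pos f m‖ ^ 2) := by
  have hint : IntegrableOn (fun θ => ‖f θ‖ ^ 2) (Ioc 0 (2 * Real.pi)) :=
    (hf.norm.pow 2).integrableOn_Ioc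
  have hL2 : MemLp f 2 (volume.restrict (Ioc (0 : ℝ) (2 * Real.pi))) :=
    (memLp_two_iff_integrable_sq_norm hf.aestronglyMeasurable).2 hint
  have hsum := (hasSum_sq_fourierCoeffOn Real.two_pi_pos hL2).mul_left (2 * Real.pi)
  rw [← ENNReal.ofReal_tsum_of_nonneg (fun m => by positivity) hsum.summable, hsum.tsum_eq,
    intervalIntegral.integral_of_le Real.two_pi_pos.le, sub_zero, smul_eq_mul,
    mul_inv_cancel_left₀ Real.two_pi_pos.ne',
    ofReal_integral_eq_lintegral_ofReal hint (ae_of_all _ fun θ => by positivity)]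
  refine lintegral_congr fun θ => ?_
  rw [ENNReal.ofReal_pow (norm_nonneg _), ofReal_norm, enorm_eq_nnnorm]

/-- Differentiation of a periodic function multiplies the Fourier coefficients by `i m`. -/
theorem fourierCoeffOn_two_pi_of_hasDerivAt {f f' : ℝ → ℂ} (hf : ∀ x, HasDerivAt f (f' x) x)
    (hf' : Continuous f') (hper : f (2 * Real.pi) = f 0) (m : ℤ) :
    fourierCoeffOn Real.two_pi_pos f' m = m * I * fourierCoeffOn Real.two_pi_pos f m := by
  have hexp : ∀ x : ℝ, HasDerivAt (fun x : ℝ => exp (-(m * I * x)))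
      (-(m * I) * exp (-(m * I * x))) x := fun x => by
    have := (((hasDerivAt_id x).ofReal_comp.const_mul (m * I)).neg).cexp
    simpa [mul_comm] using this
  have hparts := intervalIntegral.integral_mul_deriv_eq_deriv_mul
    (a := 0) (b := 2 * Real.pi) (fun x _ => hexp x) (fun x _ => hf x)
    (by apply Continuous.intervalIntegrable; fun_prop) (hf'.intervalIntegrable _ _)
  have hend : exp (-(m * I * ((2 * Real.pi : ℝ) : ℂ))) = 1 := by
    rw [exp_eq_one_iff]
    exact ⟨-m, by push_cast; ring⟩
  rw [fourierCoeffOn_two_pi_eq_integral, fourierCoeffOn_two_pi_eq_integral, hparts, hend, hper]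
  simp only [mul_assoc, intervalIntegral.integral_const_mul, ofReal_zero, mul_zero, neg_zero,
    Complex.exp_zero, real_smul, sub_self]
  ring

/-- A continuous periodic function is bounded by the sum of its Fourier coefficients. -/
theorem norm_le_tsum_norm_fourierCoeffOn {f : ℝ → ℂ} (hf : Continuous f)
    (hper : Function.Periodic f (2 * Real.pi))
    (hsum : Summable fun m => ‖fourierCoeffOn Real.two_pi_pos f m‖) (x : ℝ) :
    ‖f x‖ ≤ ∑' m : ℤ, ‖fourierCoeffOn Real.two_pi_pos f m‖ := by
  have : Fact (0 < 2 * Real.pi) := ⟨Real.two_pi_pos⟩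
  let F : C(AddCircle (2 * Real.pi), ℂ) :=
    ⟨hper.lift, continuous_quot_lift _ hf⟩
  have hF : ∀ y : ℝ, F (y : AddCircle (2 * Real.pi)) = f y := fun y => hper.lift_coe y
  have hcoeff : ∀ m, fourierCoeff F m = fourierCoeffOn Real.two_pi_pos f m := fun m => by
    rw [fourierCoeff_eq_intervalIntegral F m 0, fourierCoeffOn_eq_integral, sub_zero, zero_add]
    simp only [hF]
  have h := has_pointwise_sum_fourier_series_of_summable (f := F)
    (Summable.of_norm (by simpa only [hcoeff] using hsum)) x
  have hnorm : ∀ m : ℤ, ‖fourierCoeff F m • fourier m (x : AddCircle (2 * Real.pi))‖ =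
      ‖fourierCoeffOn Real.two_pi_pos f m‖ := fun m => by
    rw [hcoeff, norm_smul, fourier_apply, Circle.norm_coe, mul_one]
  rw [← hF, ← h.tsum_eq]
  refine (norm_tsum_le_tsum_norm ?_).trans_eq (tsum_congr hnorm)
  simpa only [hnorm] using hsum

theorem norm_fourierCoeffOn_two_pi_le {f : ℝ → ℂ} {M : ℝ} (hM : ∀ x, ‖f x‖ ≤ M) (m : ℤ) :
    ‖fourierCoeffOn Real.two_pi_pos f m‖ ≤ M := by
  rw [fourierCoeffOn_two_pi_eq_integral, norm_smul]
  have h := intervalIntegral.norm_integral_le_of_norm_le_const (a := 0) (b := 2 * Real.pi)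
    (f := fun x => exp (-(m * I * x)) * f x) (C := M) fun x _ => by
      have : ‖exp (-(m * I * x))‖ = 1 := by simp [norm_exp]
      rw [norm_mul, this, one_mul]
      exact hM x
  have hpi := Real.two_pi_pos
  rw [sub_zero, abs_of_pos hpi] at h
  rw [Real.norm_of_nonneg (by positivity), one_div, inv_mul_le_iff₀ hpi]
  linarith

section Smooth

variable {v : ℝ → ℝ → ℂ}

theorem hasDerivAt_fst_of_contDiff (hv : ContDiff ℝ (⊤ : ℕ∞) fun p : ℝ × ℝ => v p.1 p.2)
    (s θ : ℝ) : HasDerivAt (fun s' => v s' θ)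
      (fderiv ℝ (fun p : ℝ × ℝ => v p.1 p.2) (s, θ) (1, 0)) s := by
  have h := (hv.differentiable (by simp) (s, θ)).hasFDerivAt
  exact h.comp_hasDerivAt s ((hasDerivAt_id s).prodMk (hasDerivAt_const s θ))

theorem hasDerivAt_snd_of_contDiff (hv : ContDiff ℝ (⊤ : ℕ∞) fun p : ℝ × ℝ => v p.1 p.2)
    (s θ : ℝ) : HasDerivAt (fun θ' => v s θ')
      (fderiv ℝ (fun p : ℝ × ℝ => v p.1 p.2) (s, θ) (0, 1)) θ := by
  have h := (hv.differentiable (by simp) (s, θ)).hasFDerivAt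
  exact h.comp_hasDerivAt θ ((hasDerivAt_const θ s).prodMk (hasDerivAt_id θ))

theorem continuous_deriv_fst_of_contDiff
    (hv : ContDiff ℝ (⊤ : ℕ∞) fun p : ℝ × ℝ => v p.1 p.2) :
    Continuous fun p : ℝ × ℝ => deriv (fun s' => v s' p.2) p.1 := by
  simp only [(hasDerivAt_fst_of_contDiff hv _ _).deriv]
  exact (hv.continuous_fderiv (by simp)).clm_apply continuous_const

theorem continuous_deriv_snd_of_contDiff
    (hv : ContDiff ℝ (⊤ : ℕ∞) fun p : ℝ × ℝ => v p.1 p.2) :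
    Continuous fun p : ℝ × ℝ => deriv (fun θ' => v p.1 θ') p.2 := by
  simp only [(hasDerivAt_snd_of_contDiff hv _ _).deriv]
  exact (hv.continuous_fderiv (by simp)).clm_apply continuous_const

/-- Fourier coefficients may be differentiated with respect to a parameter. -/
theorem hasDerivAt_fourierCoeffOn_two_pi
    (hv : ContDiff ℝ (⊤ : ℕ∞) fun p : ℝ × ℝ => v p.1 p.2) (m : ℤ) (s : ℝ) :
    HasDerivAt (fun s' => fourierCoeffOn Real.two_pi_pos (v s') m)
      (fourierCoeffOn Real.two_pi_pos (fun θ => deriv (fun s' => v s' θ) s) m) s := by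
  simp only [fourierCoeffOn_two_pi_eq_integral]
  have hc := hv.continuous
  have hc' := continuous_deriv_fst_of_contDiff hv
  have hsec : ∀ s', Continuous (v s') := fun s' =>
    hc.comp (continuous_const.prodMk continuous_id)
  have hsec' : Continuous fun θ => deriv (fun s' => v s' θ) s :=
    hc'.comp (continuous_const.prodMk continuous_id)
  obtain ⟨B, hB⟩ := ((isCompact_Icc (a := s - 1) (b := s + 1)).prod
    (isCompact_Icc (a := 0) (b := 2 * Real.pi))).exists_bound_of_continuousOn hc'.continuousOn
  refine (intervalIntegral.hasDerivAt_integral_of_dominated_loc_of_deriv_le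
    (F := fun s' θ => exp (-(m * I * θ)) * v s' θ)
    (F' := fun s' θ => exp (-(m * I * θ)) * deriv (fun s' => v s' θ) s')
    (bound := fun _ => B) (Icc_mem_nhds (show s - 1 < s by linarith) (show s < s + 1 by linarith))
    (Filter.Eventually.of_forall fun s' => Continuous.aestronglyMeasurable (by
      have := hsec s'; fun_prop))
    (Continuous.intervalIntegrable (by have := hsec s; fun_prop) _ _)
    (Continuous.aestronglyMeasurable (by fun_prop))
    (ae_of_all _ fun θ hθ s' hs' => ?_) intervalIntegrable_const
    (ae_of_all _ fun θ _ s' _ => ?_)).2.const_smul (1 / (2 * Real.pi) : ℝ)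
  · have : ‖exp (-(m * I * θ))‖ = 1 := by simp [norm_exp]
    rw [uIoc_of_le Real.two_pi_pos.le] at hθ
    rw [norm_mul, this, one_mul]
    exact hB (s', θ) ⟨hs', Ioc_subset_Icc_self hθ⟩
  · exact (hasDerivAt_fst_of_contDiff hv s' θ).differentiableAt.hasDerivAt.const_mul _

/-- The equation acts on the `m`-th Fourier coefficient as multiplication by `m - Θ`. -/
theorem fourierCoeffOn_deriv_fst {Θ : ℝ}
    (hv : ContDiff ℝ (⊤ : ℕ∞) fun p : ℝ × ℝ => v p.1 p.2)
    (hper : ∀ s θ, v s (θ + 2 * Real.pi) = v s θ)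
    (hpde : ∀ s θ : ℝ, 0 ≤ s →
      deriv (fun s' => v s' θ) s + I * deriv (fun θ' => v s θ') θ + (Θ : ℂ) * v s θ = 0)
    (m : ℤ) {s : ℝ} (hs : 0 ≤ s) :
    fourierCoeffOn Real.two_pi_pos (fun θ => deriv (fun s' => v s' θ) s) m =
      ((m - Θ : ℝ) : ℂ) * fourierCoeffOn Real.two_pi_pos (v s) m := by
  have hsec : Continuous (v s) := hv.continuous.comp (continuous_const.prodMk continuous_id)
  have hsec' : Continuous fun θ => deriv (v s) θ :=
    (continuous_deriv_snd_of_contDiff hv).comp (continuous_const.prodMk continuous_id)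
  have hder := fourierCoeffOn_two_pi_of_hasDerivAt
    (fun θ => (hasDerivAt_snd_of_contDiff hv s θ).differentiableAt.hasDerivAt) hsec'
    (by simpa using hper s 0) m
  have hrew : (fun θ => deriv (fun s' => v s' θ) s) =
      fun θ => -I * deriv (v s) θ - Θ * v s θ := by
    funext θ
    linear_combination hpde s θ hs
  have hlin : fourierCoeffOn Real.two_pi_pos (fun θ => -I * deriv (v s) θ - Θ * v s θ) m =
      -I * fourierCoeffOn Real.two_pi_pos (deriv (v s)) m -
        Θ * fourierCoeffOn Real.two_pi_pos (v s) m := by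
    simp only [fourierCoeffOn_two_pi_eq_integral, mul_sub, real_smul]
    rw [intervalIntegral.integral_sub (Continuous.intervalIntegrable (by fun_prop) _ _)
      (Continuous.intervalIntegrable (by fun_prop) _ _)]
    simp only [mul_left_comm _ (-I), mul_left_comm _ (Θ : ℂ),
      intervalIntegral.integral_const_mul]
    ring
  rw [hrew, hlin, hder]
  push_cast
  linear_combination (-(m : ℂ) * fourierCoeffOn Real.two_pi_pos (v s) m) * I_mul_I

theorem fourierCoeffOn_eq_exp_mul {Θ : ℝ}
    (hv : ContDiff ℝ (⊤ : ℕ∞) fun p : ℝ × ℝ => v p.1 p.2)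
    (hper : ∀ s θ, v s (θ + 2 * Real.pi) = v s θ)
    (hpde : ∀ s θ : ℝ, 0 ≤ s →
      deriv (fun s' => v s' θ) s + I * deriv (fun θ' => v s θ') θ + (Θ : ℂ) * v s θ = 0)
    (m : ℤ) {s : ℝ} (hs : 0 ≤ s) :
    fourierCoeffOn Real.two_pi_pos (v s) m =
      Real.exp ((m - Θ) * s) * fourierCoeffOn Real.two_pi_pos (v 0) m := by
  have hexp : ∀ t : ℝ, HasDerivAt (fun t : ℝ => ((Real.exp (-((m - Θ) * t)) : ℝ) : ℂ))
      ((Real.exp (-((m - Θ) * t)) * -(m - Θ) : ℝ) : ℂ) t := fun t => by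
    have h := (((hasDerivAt_id t).const_mul (m - Θ : ℝ)).neg).exp.ofReal_comp
    simpa using h
  have hprod : ∀ t : ℝ, HasDerivAt
      (fun t => ((Real.exp (-((m - Θ) * t)) : ℝ) : ℂ) * fourierCoeffOn Real.two_pi_pos (v t) m)
      _ t := fun t => (hexp t).mul (hasDerivAt_fourierCoeffOn_two_pi hv m t)
  have hconst := constant_of_has_deriv_right_zero (a := 0) (b := s)
    (fun t _ => (hprod t).continuousAt.continuousWithinAt)
    (fun t ht => by
      refine ((hprod t).congr_deriv ?_).hasDerivWithinAt
      rw [fourierCoeffOn_deriv_fst hv hper hpde m ht.1]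
      push_cast
      ring) s ⟨hs, le_rfl⟩
  simp only [mul_zero, neg_zero, Real.exp_zero, ofReal_one, one_mul] at hconst
  rw [← hconst, ← mul_assoc, ← ofReal_mul, ← Real.exp_add, add_neg_cancel, Real.exp_zero,
    ofReal_one, one_mul]

/-- The energy of the modes `e^{-inθ}` with `n ≥ 0` is at most the total energy. -/
theorem tsum_energy_le {Θ : ℝ}
    (hv : ContDiff ℝ (⊤ : ℕ∞) fun p : ℝ × ℝ => v p.1 p.2)
    (hper : ∀ s θ, v s (θ + 2 * Real.pi) = v s θ)
    (hpde : ∀ s θ : ℝ, 0 ≤ s →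
      deriv (fun s' => v s' θ) s + I * deriv (fun θ' => v s θ') θ + (Θ : ℂ) * v s θ = 0)
    (hΘ0 : 0 < Θ) :
    ∑' n : ℕ, ENNReal.ofReal
        (Real.pi * (n + Θ) * ‖fourierCoeffOn Real.two_pi_pos (v 0) (-(n : ℤ))‖ ^ 2) ≤
      ∫⁻ s in Ioi (0 : ℝ), ∫⁻ θ in Ioc (0 : ℝ) (2 * Real.pi),
        (‖deriv (fun s' => v s' θ) s‖₊ : ℝ≥0∞) ^ 2 := by
  set A : ℕ → ℝ := fun n => ‖fourierCoeffOn Real.two_pi_pos (v 0) (-(n : ℤ))‖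
  have hmode : ∀ n : ℕ, ENNReal.ofReal (Real.pi * (n + Θ) * A n ^ 2) =
      ∫⁻ s in Ioi (0 : ℝ), ENNReal.ofReal
        (2 * Real.pi * (n + Θ) ^ 2 * A n ^ 2 * Real.exp (-2 * (n + Θ) * s)) := fun n => by
    have hneg : -2 * (n + Θ) < 0 := by nlinarith [n.cast_nonneg (α := ℝ)]
    have hne : (n : ℝ) + Θ ≠ 0 := by positivity
    rw [← ofReal_integral_eq_lintegral_ofReal
      ((integrableOn_exp_mul_Ioi hneg 0).const_mul _) (ae_of_all _ fun s => by positivity),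
      integral_const_mul, integral_exp_mul_Ioi hneg, mul_zero, Real.exp_zero]
    congr 1
    field_simp
  change ∑' n : ℕ, ENNReal.ofReal (Real.pi * (n + Θ) * A n ^ 2) ≤ _
  simp only [hmode]
  rw [← lintegral_tsum fun n => by fun_prop]
  refine setLIntegral_mono' measurableSet_Ioi fun s hs => ?_
  rw [lintegral_sq_eq_tsum_fourierCoeffOn (f := fun θ => deriv (fun s' => v s' θ) s)
      ((continuous_deriv_fst_of_contDiff hv).comp (continuous_const.prodMk continuous_id))]
  refine le_trans (ENNReal.tsum_le_tsum fun n => ENNReal.ofReal_le_ofReal (le_of_eq ?_))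
    (ENNReal.tsum_comp_le_tsum_of_injective (f := fun n : ℕ => -(n : ℤ))
      (neg_injective.comp Nat.cast_injective) _)
  rw [fourierCoeffOn_deriv_fst hv hper hpde _ (mem_Ioi.1 hs).le,
    fourierCoeffOn_eq_exp_mul hv hper hpde _ (mem_Ioi.1 hs).le, norm_mul, norm_mul, norm_real,
    norm_real, mul_pow, mul_pow, Real.norm_eq_abs, sq_abs, Real.norm_eq_abs, sq_abs,
    ← Real.exp_nat_mul]
  have : ((2 : ℕ) : ℝ) * ((((-(n : ℤ) : ℤ) : ℝ) - Θ) * s) = -2 * (n + Θ) * s := by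
    push_cast; ring
  rw [this]
  push_cast
  ring

/-- Cauchy-Schwarz bound for the Fourier coefficients of a circle slice. -/
theorem sum_norm_fourierCoeffOn_le {Θ : ℝ}
    (hv : ContDiff ℝ (⊤ : ℕ∞) fun p : ℝ × ℝ => v p.1 p.2)
    (hper : ∀ s θ, v s (θ + 2 * Real.pi) = v s θ)
    (hpde : ∀ s θ : ℝ, 0 ≤ s →
      deriv (fun s' => v s' θ) s + I * deriv (fun θ' => v s θ') θ + (Θ : ℂ) * v s θ = 0)
    (hΘ0 : 0 < Θ) {E T : ℝ} (hT : 0 < T)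
    (hE : ∀ F : Finset ℕ, ∑ n ∈ F,
      Real.pi * (n + Θ) * ‖fourierCoeffOn Real.two_pi_pos (v 0) (-(n : ℤ))‖ ^ 2 ≤ E)
    {s : ℝ} (hs : T ≤ s) (F : Finset ℕ) :
    ∑ n ∈ F, ‖fourierCoeffOn Real.two_pi_pos (v s) (-(n : ℤ))‖ ≤
      √(2 / Θ) * Real.exp (-Θ * s) * √E * (1 - Real.exp (-2 * T)) ^ (-(1 : ℝ) / 2) := by
  have hE0 : 0 ≤ E := by simpa using hE ∅
  have hq : Real.exp (-2 * T) < 1 := Real.exp_lt_one_iff.2 (by linarith)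
  have hD : 0 < 1 - Real.exp (-2 * T) := by linarith
  set A : ℕ → ℝ := fun n => ‖fourierCoeffOn Real.two_pi_pos (v 0) (-(n : ℤ))‖
  have hterm : ∀ n : ℕ, ‖fourierCoeffOn Real.two_pi_pos (v s) (-(n : ℤ))‖ =
      Real.exp (-Θ * s) * (√(n + Θ) * A n * (Real.exp (-n * s) / √(n + Θ))) := fun n => by
    have hne : √((n : ℝ) + Θ) ≠ 0 := (Real.sqrt_pos.2 (by positivity)).ne'
    rw [fourierCoeffOn_eq_exp_mul hv hper hpde _ (hT.le.trans hs), norm_mul, norm_real,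
      Real.norm_of_nonneg (Real.exp_pos _).le]
    have : (((-(n : ℤ) : ℤ) : ℝ) - Θ) * s = -Θ * s + -n * s := by push_cast; ring
    rw [this, Real.exp_add]
    field_simp
    rfl
  have hfst : ∑ n ∈ F, (√(n + Θ) * A n) ^ 2 ≤ E := by
    refine le_trans (Finset.sum_le_sum fun n _ => ?_) (hE F)
    rw [mul_pow, Real.sq_sqrt (by positivity)]
    gcongr
    have : (0 : ℝ) ≤ n + Θ := by positivity
    nlinarith [Real.pi_gt_three]
  have hsnd : ∑ n ∈ F, (Real.exp (-n * s) / √(n + Θ)) ^ 2 ≤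
      2 / Θ * (1 - Real.exp (-2 * T))⁻¹ := by
    have hgeom : ∑ n ∈ F, Real.exp (-2 * T) ^ n ≤ (1 - Real.exp (-2 * T))⁻¹ := by
      rw [← tsum_geometric_of_lt_one (Real.exp_pos _).le hq]
      exact (summable_geometric_of_lt_one (Real.exp_pos _).le hq).sum_le_tsum F
        fun n _ => by positivity
    refine le_trans ?_ (mul_le_mul_of_nonneg_left hgeom (by positivity))
    rw [Finset.mul_sum]
    refine Finset.sum_le_sum fun n _ => ?_
    rw [div_pow, Real.sq_sqrt (by positivity), ← Real.exp_nat_mul, ← Real.exp_nat_mul,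
      div_mul_eq_mul_div, div_le_div_iff₀ (by positivity) hΘ0]
    have hexp : Real.exp (((2 : ℕ) : ℝ) * (-n * s)) ≤ Real.exp (n * (-2 * T)) := by
      rw [Real.exp_le_exp]
      push_cast
      nlinarith [n.cast_nonneg (α := ℝ)]
    have hpos := Real.exp_pos (n * (-2 * T))
    have hn : (0 : ℝ) ≤ n := n.cast_nonneg
    nlinarith [mul_le_mul_of_nonneg_right hexp hΘ0.le, mul_pos hpos hΘ0, mul_nonneg hpos.le hn]
  have hpow : (1 - Real.exp (-2 * T)) ^ (-(1 : ℝ) / 2) = √((1 - Real.exp (-2 * T))⁻¹) := by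
    rw [neg_div, Real.rpow_neg hD.le, ← Real.sqrt_eq_rpow, Real.sqrt_inv]
  have hCS : ∑ n ∈ F, √(n + Θ) * A n * (Real.exp (-n * s) / √(n + Θ)) ≤
      √E * √(2 / Θ * (1 - Real.exp (-2 * T))⁻¹) := by
    refine (Real.sum_mul_le_sqrt_mul_sqrt F _ _).trans ?_
    gcongr
  simp only [hterm]
  rw [← Finset.mul_sum, hpow]
  refine (mul_le_mul_of_nonneg_left hCS (Real.exp_pos _).le).trans_eq ?_
  rw [Real.sqrt_mul (by positivity)]
  ring

/-- Boundedness excludes the modes `e^{imθ}` with `m > 0`. -/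
theorem fourierCoeffOn_eq_zero_of_pos {Θ : ℝ}
    (hv : ContDiff ℝ (⊤ : ℕ∞) fun p : ℝ × ℝ => v p.1 p.2)
    (hper : ∀ s θ, v s (θ + 2 * Real.pi) = v s θ)
    (hpde : ∀ s θ : ℝ, 0 ≤ s →
      deriv (fun s' => v s' θ) s + I * deriv (fun θ' => v s θ') θ + (Θ : ℂ) * v s θ = 0)
    (hbdd : ∃ M : ℝ, ∀ s θ : ℝ, 0 ≤ s → ‖v s θ‖ ≤ M)
    (hΘ1 : Θ < 1) {m : ℤ} (hm : 0 < m) {s : ℝ} (hs : 0 ≤ s) :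
    fourierCoeffOn Real.two_pi_pos (v s) m = 0 := by
  obtain ⟨M, hM⟩ := hbdd
  rw [fourierCoeffOn_eq_exp_mul hv hper hpde m hs]
  suffices h : fourierCoeffOn Real.two_pi_pos (v 0) m = 0 by rw [h, mul_zero]
  by_contra hne
  have hpos : 0 < (m : ℝ) - Θ := by
    have : (1 : ℝ) ≤ m := by exact_mod_cast hm
    linarith
  have hlim : Filter.Tendsto
      (fun t => Real.exp ((m - Θ) * t) * ‖fourierCoeffOn Real.two_pi_pos (v 0) m‖)
      Filter.atTop Filter.atTop :=
    (Real.tendsto_exp_atTop.comp (Filter.tendsto_id.const_mul_atTop hpos)).atTop_mul_const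
      (norm_pos_iff.2 hne)
  obtain ⟨t, ht, ht0⟩ :=
    ((hlim.eventually_gt_atTop M).and (Filter.eventually_ge_atTop 0)).exists
  have hle := norm_fourierCoeffOn_two_pi_le (fun θ => hM t θ ht0) m
  rw [fourierCoeffOn_eq_exp_mul hv hper hpde m ht0, norm_mul, norm_real,
    Real.norm_of_nonneg (Real.exp_pos _).le] at hle
  exact absurd hle (not_le.2 ht)

/-- The estimate on each circle behind the integral estimate. -/
theorem lintegral_circle_le {Θ : ℝ}
    (hv : ContDiff ℝ (⊤ : ℕ∞) fun p : ℝ × ℝ => v p.1 p.2)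
    (hper : ∀ s θ, v s (θ + 2 * Real.pi) = v s θ)
    (hpde : ∀ s θ : ℝ, 0 ≤ s →
      deriv (fun s' => v s' θ) s + I * deriv (fun θ' => v s θ') θ + (Θ : ℂ) * v s θ = 0)
    (hbdd : ∃ M : ℝ, ∀ s θ : ℝ, 0 ≤ s → ‖v s θ‖ ≤ M)
    (hΘ0 : 0 < Θ) (hΘ1 : Θ < 1) {s : ℝ} (hs : 0 ≤ s) :
    ∫⁻ θ in Ioc (0 : ℝ) (2 * Real.pi), (‖v s θ‖₊ : ℝ≥0∞) ^ 2 ≤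
      ENNReal.ofReal (1 / Θ ^ 2) * ∫⁻ θ in Ioc (0 : ℝ) (2 * Real.pi),
        (‖deriv (fun s' => v s' θ) s‖₊ : ℝ≥0∞) ^ 2 := by
  rw [lintegral_sq_eq_tsum_fourierCoeffOn (f := v s)
      (hv.continuous.comp (continuous_const.prodMk continuous_id)),
    lintegral_sq_eq_tsum_fourierCoeffOn (f := fun θ => deriv (fun s' => v s' θ) s)
      ((continuous_deriv_fst_of_contDiff hv).comp (continuous_const.prodMk continuous_id)),
    ← ENNReal.tsum_mul_left]
  refine ENNReal.tsum_le_tsum fun m => ?_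
  rw [← ENNReal.ofReal_mul (by positivity)]
  refine ENNReal.ofReal_le_ofReal ?_
  rw [fourierCoeffOn_deriv_fst hv hper hpde m hs]
  rcases lt_or_ge 0 m with hm | hm
  · simp [fourierCoeffOn_eq_zero_of_pos hv hper hpde hbdd hΘ1 hm hs]
  · have hm' : (m : ℝ) ≤ 0 := by exact_mod_cast hm
    rw [norm_mul, norm_real, mul_pow, Real.norm_eq_abs, sq_abs, one_div, ← div_eq_inv_mul,
      le_div_iff₀ (by positivity)]
    have hsq : Θ ^ 2 ≤ ((m : ℝ) - Θ) ^ 2 := by nlinarith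
    have := mul_le_mul_of_nonneg_left hsq (show 0 ≤ 2 * Real.pi *
      ‖fourierCoeffOn Real.two_pi_pos (v s) m‖ ^ 2 by positivity)
    linarith

end Smooth

end

/-- a smooth bounded solution of `(∂_s + i∂_θ + Θ)v = 0` on the
half-cylinder `[0,∞) × S¹` with square-integrable `∂_s v` satisfies, for every
`T > 0`, the integral estimate
`∫_T^∞∫_{S¹} |v|² ≤ Θ⁻² ∫_T^∞∫_{S¹} |∂_s v|²` and the pointwise decay estimate
`|v(s,θ)| ≤ √(2/Θ) e^{−Θs} (∫_0^∞∫_{S¹}|∂_s v|²)^{1/2} (1−e^{−2T})^{−1/2}` for `s ≥ T`. -/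
theorem cylinder_decay_estimate (Θ : ℝ) (hΘ0 : 0 < Θ) (hΘ1 : Θ < 1)
    (v : ℝ → ℝ → ℂ)
    (hsmooth : ContDiff ℝ (⊤ : ℕ∞) (fun p : ℝ × ℝ => v p.1 p.2))
    (hper : ∀ s θ, v s (θ + 2 * Real.pi) = v s θ)
    (hbdd : ∃ M : ℝ, ∀ s θ : ℝ, 0 ≤ s → ‖v s θ‖ ≤ M)
    (hpde : ∀ s θ : ℝ, 0 ≤ s →
      deriv (fun s' => v s' θ) s + Complex.I * deriv (fun θ' => v s θ') θ
        + (Θ : ℂ) * v s θ = 0)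
    (henergy : (∫⁻ s in Set.Ioi (0 : ℝ), ∫⁻ θ in Set.Ioc (0 : ℝ) (2 * Real.pi),
        ((‖deriv (fun s' => v s' θ) s‖₊ : ℝ≥0∞) ^ 2)) < ⊤)
    (T : ℝ) (hT : 0 < T) :
    (∫⁻ s in Set.Ioi T, ∫⁻ θ in Set.Ioc (0 : ℝ) (2 * Real.pi),
        ((‖v s θ‖₊ : ℝ≥0∞) ^ 2))
      ≤ ENNReal.ofReal (1 / Θ ^ 2) *
        ∫⁻ s in Set.Ioi T, ∫⁻ θ in Set.Ioc (0 : ℝ) (2 * Real.pi),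
          ((‖deriv (fun s' => v s' θ) s‖₊ : ℝ≥0∞) ^ 2) ∧
    ∀ s θ : ℝ, T ≤ s →
      ‖v s θ‖ ≤ Real.sqrt (2 / Θ) * Real.exp (-Θ * s) *
        Real.sqrt ((∫⁻ s in Set.Ioi (0 : ℝ), ∫⁻ θ in Set.Ioc (0 : ℝ) (2 * Real.pi),
          ((‖deriv (fun s' => v s' θ) s‖₊ : ℝ≥0∞) ^ 2)).toReal) *
        (1 - Real.exp (-2 * T)) ^ (-(1 : ℝ) / 2) := by
  constructor
  · rw [← lintegral_const_mul' _ _ ENNReal.ofReal_ne_top]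
    exact setLIntegral_mono' measurableSet_Ioi fun s hs =>
      lintegral_circle_le hsmooth hper hpde hbdd hΘ0 hΘ1 (hT.trans hs).le
  · intro s θ hs
    have hs0 : 0 ≤ s := hT.le.trans hs
    have hinj : Function.Injective fun n : ℕ => -(n : ℤ) :=
      neg_injective.comp Nat.cast_injective
    have hzero : ∀ m ∉ Set.range fun n : ℕ => -(n : ℤ),
        ‖fourierCoeffOn Real.two_pi_pos (v s) m‖ = 0 := fun m hm => by
      rw [fourierCoeffOn_eq_zero_of_pos hsmooth hper hpde hbdd hΘ1 _ hs0, norm_zero]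
      by_contra hle
      exact hm ⟨m.natAbs, by simp only; omega⟩
    have hE : ∀ F : Finset ℕ, ∑ n ∈ F, Real.pi * (n + Θ) *
        ‖fourierCoeffOn Real.two_pi_pos (v 0) (-(n : ℤ))‖ ^ 2 ≤
        (∫⁻ s in Set.Ioi (0 : ℝ), ∫⁻ θ in Set.Ioc (0 : ℝ) (2 * Real.pi),
          ((‖deriv (fun s' => v s' θ) s‖₊ : ℝ≥0∞) ^ 2)).toReal := fun F => by
      rw [← ENNReal.ofReal_le_iff_le_toReal henergy.ne,
        ENNReal.ofReal_sum_of_nonneg fun n _ => by positivity]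
      exact (ENNReal.sum_le_tsum F).trans (tsum_energy_le hsmooth hper hpde hΘ0)
    have hbound := sum_norm_fourierCoeffOn_le hsmooth hper hpde hΘ0 hT hE hs
    have hsum : Summable fun m => ‖fourierCoeffOn Real.two_pi_pos (v s) m‖ :=
      (hinj.summable_iff hzero).1 (summable_of_sum_le (fun n => norm_nonneg _) hbound)
    refine (norm_le_tsum_norm_fourierCoeffOn (f := v s)
      (hsmooth.continuous.comp (continuous_const.prodMk continuous_id)) (hper s) hsum θ).trans ?_
    rw [← hinj.tsum_eq (Function.support_subset_iff'.2 hzero)]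
    exact Real.tsum_le_of_sum_le (fun n => norm_nonneg _) hbound
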